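/- arXiv:1608.05920 — 5 statements merged into one kernel-verified Lean document; each statement's English description precedes it below -/
import Mathlib

section
/- The periodic points of G_{f₀} are dense in (𝒳, d): for every point X ∈ 𝒳 and every ε > 0, there exists Y ∈ 𝒳 with d(X,Y) < ε and an integer n ≥ 1 such that G_{f₀}^n(Y) = Y. -/
open scoped BigOperators

/-- The strategy distance `d_s`. -/
noncomputable def ds (N : ℕ) (S T : ℕ → Fin N) : ℝ :=
  (9 / N) * ∑' k : ℕ, |((S k : ℕ) : ℝ) - ((T k : ℕ) : ℝ)| / 10 ^ (k + 1)

/-- The state distance `d_e`: number of differing cells. -/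
def de (N : ℕ) (E F : Fin N → Bool) : ℕ :=
  (Finset.univ.filter fun j => E j ≠ F j).card

/-- The distance `d` on the phase space `𝒳 = (ℕ → Fin N) × (Fin N → Bool)`. -/
noncomputable def dX (N : ℕ) (X Y : (ℕ → Fin N) × (Fin N → Bool)) : ℝ :=
  (de N X.2 Y.2 : ℝ) + ds N X.1 Y.1
/-- The map `F_f`. -/
def Ff (N : ℕ) (f : (Fin N → Bool) → (Fin N → Bool))
    (k : Fin N) (E : Fin N → Bool) : Fin N → Bool :=
  fun j => if j = k then f E j else E j

/-- The map `G_f` on the phase space. -/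
def Gf (N : ℕ) (f : (Fin N → Bool) → (Fin N → Bool)) :
    ((ℕ → Fin N) × (Fin N → Bool)) → ((ℕ → Fin N) × (Fin N → Bool)) :=
  fun X => (fun n => X.1 (n + 1), Ff N f (X.1 0) X.2)

/-- The vectorial negation `f₀`. -/
def f0 (N : ℕ) : (Fin N → Bool) → (Fin N → Bool) := fun E j => !(E j)

theorem iter_fst (N : ℕ) (n : ℕ) (Y : (ℕ → Fin N) × (Fin N → Bool)) :
    ((Gf N (f0 N))^[n] Y).1 = fun k => Y.1 (k + n) := by
  induction n with
  | zero => rfl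
  | succ n ih =>
    rw [Function.iterate_succ_apply']
    funext k
    simp only [Gf, ih]
    rw [show k + 1 + n = k + (n + 1) by omega]

theorem iter_snd (N : ℕ) (n : ℕ) (Y : (ℕ → Fin N) × (Fin N → Bool)) (j : Fin N) :
    ((Gf N (f0 N))^[n] Y).2 j =
      if (∑ k ∈ Finset.range n, if j = Y.1 k then 1 else 0) % 2 = 0 then Y.2 j else !(Y.2 j) := by
  induction n with
  | zero => simp
  | succ n ih =>
    rw [Function.iterate_succ_apply', Finset.sum_range_succ]
    have h := iter_fst N n Y
    simp only [Gf, Ff, f0, h, ih, Nat.zero_add]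
    generalize (∑ k ∈ Finset.range n, if j = Y.1 k then 1 else 0) = s
    by_cases hj : j = Y.1 n
    · simp only [hj, if_true]
      rcases Nat.mod_two_eq_zero_or_one s with h | h
      · have : (s + 1) % 2 = 1 := by omega
        simp [h, this]
      · have : (s + 1) % 2 = 0 := by omega
        simp [h, this]
    · simp [hj]

theorem ds_le (N : ℕ) (hN : 1 ≤ N) (m : ℕ) (S T : ℕ → Fin N) (h : ∀ k < m, S k = T k) :
    ds N S T ≤ (1 / 10 : ℝ) ^ m := by
  have hN' : (0 : ℝ) < N := by exact_mod_cast hN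
  set t : ℕ → ℝ := fun k => |((S k : ℕ) : ℝ) - ((T k : ℕ) : ℝ)| / 10 ^ (k + 1) with ht
  have hb : ∀ k, t k ≤ (N / 10 : ℝ) * (1 / 10 : ℝ) ^ k := by
    intro k
    have h1 : |((S k : ℕ) : ℝ) - ((T k : ℕ) : ℝ)| ≤ N := by
      have a : ((S k : ℕ) : ℝ) ≤ N := by exact_mod_cast (S k).2.le
      have b : ((T k : ℕ) : ℝ) ≤ N := by exact_mod_cast (T k).2.le
      have a' : (0 : ℝ) ≤ ((S k : ℕ) : ℝ) := by positivity
      have b' : (0 : ℝ) ≤ ((T k : ℕ) : ℝ) := by positivity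
      rw [abs_le]; constructor <;> linarith
    have h2 : (N / 10 : ℝ) * (1 / 10 : ℝ) ^ k = N / 10 ^ (k + 1) := by
      rw [div_pow, pow_succ]; field_simp; simp
    rw [h2]
    simp only [ht]
    gcongr
  have hg : HasSum (fun k : ℕ => (1 / 10 : ℝ) ^ k) (1 - 1 / 10)⁻¹ :=
    hasSum_geometric_of_lt_one (by norm_num) (by norm_num)
  have hs : Summable t :=
    Summable.of_nonneg_of_le (fun k => by positivity) hb (hg.summable.mul_left _)
  have hz : ∑ k ∈ Finset.range m, t k = 0 := by
    apply Finset.sum_eq_zero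
    intro k hk
    simp [ht, h k (Finset.mem_range.1 hk)]
  have he := hs.sum_add_tsum_nat_add m
  rw [hz, zero_add] at he
  have hg' := hg.mul_left ((N / 10 : ℝ) * (1 / 10 : ℝ) ^ m)
  have hle : ∑' k, t (k + m) ≤ (N / 10 : ℝ) * (1 / 10 : ℝ) ^ m * (1 - 1 / 10)⁻¹ := by
    rw [← hg'.tsum_eq]
    refine Summable.tsum_le_tsum (fun k => ?_) ((summable_nat_add_iff m).2 hs) hg'.summable
    refine (hb _).trans (le_of_eq ?_)
    rw [pow_add]; ring
  unfold ds
  rw [← he]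
  calc (9 / N : ℝ) * ∑' k, t (k + m)
      ≤ (9 / N : ℝ) * ((N / 10 : ℝ) * (1 / 10 : ℝ) ^ m * (1 - 1 / 10)⁻¹) := by gcongr
    _ = (1 / 10 : ℝ) ^ m := by
      generalize (1 / 10 : ℝ) ^ m = q
      field_simp
      norm_num
      ring

/-- periodic points of `G_{f₀}` are dense in `(𝒳, d)`. -/
theorem periodic_points_dense (N : ℕ) (hN : 1 ≤ N) :
    ∀ X : (ℕ → Fin N) × (Fin N → Bool), ∀ ε : ℝ, 0 < ε →
      ∃ Y : (ℕ → Fin N) × (Fin N → Bool),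
        dX N X Y < ε ∧ ∃ n : ℕ, 1 ≤ n ∧ (Gf N (f0 N))^[n] Y = Y := by
  intro X ε hε
  obtain ⟨m, hm⟩ := exists_pow_lt_of_lt_one hε (by norm_num : (1 / 10 : ℝ) < 1)
  have hm' : (1 / 10 : ℝ) ^ (m + 1) < ε :=
    lt_of_le_of_lt (pow_le_pow_of_le_one (by norm_num) (by norm_num) (Nat.le_succ m)) hm
  refine ⟨(fun k => X.1 (k % (m + 1)), X.2), ?_, (m + 1) + (m + 1), by omega, ?_⟩
  · have h := ds_le N hN (m + 1) X.1 (fun k => X.1 (k % (m + 1)))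
      (fun k hk => by simp only [Nat.mod_eq_of_lt hk])
    simp only [dX, de, ne_eq, not_true_eq_false, Finset.filter_false, Finset.card_empty,
      Nat.cast_zero, zero_add]
    exact lt_of_le_of_lt h hm'
  · apply Prod.ext
    · rw [iter_fst]
      funext k
      change X.1 ((k + ((m + 1) + (m + 1))) % (m + 1)) = X.1 (k % (m + 1))
      rw [← Nat.add_assoc k (m + 1) (m + 1), Nat.add_mod_right, Nat.add_mod_right]
    · funext j
      rw [iter_snd, Finset.sum_range_add]
      simp only [Nat.add_mod_left]
      rw [if_pos (by omega)]
end

section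
/- G_{f₀} is chaotic on (𝒳, d) in the sense of Devaney: the set of periodic points of G_{f₀} is dense in 𝒳, and G_{f₀} is topologically transitive (for every pair of nonempty open sets U, V ⊆ 𝒳, there exists k > 0 with G_{f₀}^k(U) ∩ V ≠ ∅). -/
open scoped BigOperators

lemma ds_small (N : ℕ) (hN : 1 ≤ N) (ε : ℝ) (hε : 0 < ε) :
    ∃ m : ℕ, ∀ S T : ℕ → Fin N, (∀ k < m, S k = T k) → ds N S T < ε := by
  obtain ⟨m, hm⟩ := exists_pow_lt_of_lt_one (show (0 : ℝ) < ε / 12 by positivity)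
    (show (1 / 2 : ℝ) < 1 by norm_num)
  refine ⟨m, fun S T h => ?_⟩
  have hN' : (0 : ℝ) < N := by exact_mod_cast hN
  have hgeo : HasSum (fun k : ℕ => (N * (1 / 2 : ℝ) ^ m) * (1 / 5 : ℝ) ^ k)
      ((N * (1 / 2 : ℝ) ^ m) * (1 - 1 / 5)⁻¹) :=
    (hasSum_geometric_of_lt_one (by norm_num) (by norm_num)).mul_left _
  have hle : ∀ k : ℕ, |((S k : ℕ) : ℝ) - ((T k : ℕ) : ℝ)| / 10 ^ (k + 1)
      ≤ (N * (1 / 2 : ℝ) ^ m) * (1 / 5 : ℝ) ^ k := by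
    intro k
    by_cases hk : k < m
    · rw [h k hk]; simp
    · have h1 : |((S k : ℕ) : ℝ) - ((T k : ℕ) : ℝ)| ≤ N := by
        have a1 : ((S k : ℕ) : ℝ) ≤ N := by exact_mod_cast (S k).2.le
        have a2 : ((T k : ℕ) : ℝ) ≤ N := by exact_mod_cast (T k).2.le
        have a3 : (0 : ℝ) ≤ ((S k : ℕ) : ℝ) := by positivity
        have a4 : (0 : ℝ) ≤ ((T k : ℕ) : ℝ) := by positivity
        rw [abs_le]; constructor <;> linarith
      have h2 : (1 / 2 : ℝ) ^ k ≤ (1 / 2 : ℝ) ^ m :=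
        pow_le_pow_of_le_one (by norm_num) (by norm_num) (by omega)
      have h3 : (1 : ℝ) / 10 ^ (k + 1) ≤ (1 / 2 : ℝ) ^ k * (1 / 5 : ℝ) ^ k := by
        rw [← mul_pow, show (1 / 2 : ℝ) * (1 / 5) = 1 / 10 by norm_num, div_pow, one_pow]
        apply one_div_le_one_div_of_le (by positivity)
        exact pow_le_pow_right₀ (by norm_num) (by omega)
      calc _ = |((S k : ℕ) : ℝ) - ((T k : ℕ) : ℝ)| * (1 / 10 ^ (k + 1)) := by ring
        _ ≤ N * ((1 / 2 : ℝ) ^ m * (1 / 5 : ℝ) ^ k) := by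
          apply mul_le_mul h1 _ (by positivity) (by positivity)
          exact h3.trans (by gcongr)
        _ = _ := by ring
  have hs := Summable.of_nonneg_of_le (fun k => by positivity) hle hgeo.summable
  have ht := (hs.tsum_le_tsum hle hgeo.summable).trans_eq hgeo.tsum_eq
  unfold ds
  calc _ ≤ (9 / N : ℝ) * ((N * (1 / 2 : ℝ) ^ m) * (1 - 1 / 5)⁻¹) := by gcongr
    _ = 45 / 4 * (1 / 2 : ℝ) ^ m := by field_simp; norm_num
    _ < ε := by linarith

/-- prepend a finite word to a strategy -/
def prep {N : ℕ} (l : List (Fin N)) (S : ℕ → Fin N) : ℕ → Fin N :=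
  fun n => if h : n < l.length then l[n] else S (n - l.length)

lemma iter_prep (N : ℕ) (l : List (Fin N)) (S : ℕ → Fin N) (E : Fin N → Bool) :
    (Gf N (f0 N))^[l.length] (prep l S, E) =
      (S, l.foldl (fun E a => Ff N (f0 N) a E) E) := by
  induction l generalizing E with
  | nil =>
    have : prep [] S = S := by funext n; simp [prep]
    simp [this]
  | cons a l ih =>
    rw [List.length_cons, Function.iterate_succ_apply]
    have : Gf N (f0 N) (prep (a :: l) S, E) = (prep l S, Ff N (f0 N) a E) := by
      simp [Gf, prep]
      rfl
    rw [this, ih]; rfl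

lemma reach (N : ℕ) (E E' : Fin N → Bool) :
    ∃ l : List (Fin N), l.foldl (fun E a => Ff N (f0 N) a E) E = E' := by
  have key : ∀ s : Finset (Fin N), ∃ l : List (Fin N),
      l.foldl (fun E a => Ff N (f0 N) a E) E = fun j => if j ∈ s then !(E j) else E j := by
    intro s
    induction s using Finset.induction_on with
    | empty => exact ⟨[], by simp⟩
    | insert a s ha ih =>
      obtain ⟨l, hl⟩ := ih
      refine ⟨l ++ [a], ?_⟩
      rw [List.foldl_append, hl]
      funext j
      by_cases hj : j = a
      · subst hj; simp [Ff, f0, ha]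
      · simp [Ff, hj]
  obtain ⟨l, hl⟩ := key (Finset.univ.filter fun j => E j ≠ E' j)
  refine ⟨l, hl.trans ?_⟩
  funext j
  cases h1 : E j <;> cases h2 : E' j <;> simp [h1, h2]

lemma de_self (N : ℕ) (E : Fin N → Bool) : de N E E = 0 := by simp [de]

/-- A word starting with the first terms of `S`, leading from `E` to `E'`. -/
lemma word (N : ℕ) (S : ℕ → Fin N) (E E' : Fin N → Bool) (m : ℕ) :
    ∃ l : List (Fin N), 0 < l.length ∧ (∀ T, ∀ k < m, S k = prep l T k) ∧
      l.foldl (fun E a => Ff N (f0 N) a E) E = E' := by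
  let l1 := List.ofFn (fun i : Fin (m + 1) => S i)
  obtain ⟨l2, h2⟩ := reach N (l1.foldl (fun E a => Ff N (f0 N) a E) E) E'
  refine ⟨l1 ++ l2, by simp [l1], fun T k hk => ?_, by rw [List.foldl_append, h2]⟩
  have hk1 : k < l1.length := by simp [l1]; omega
  have hk2 : k < (l1 ++ l2).length := by rw [List.length_append]; omega
  rw [prep, dif_pos hk2, List.getElem_append_left hk1]
  exact (List.getElem_ofFn (f := fun i : Fin (m + 1) => S i) hk1).symm

/-- `G_{f₀}` is chaotic in the sense of Devaney: dense periodic points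
and topological transitivity. -/
theorem Gf0_Devaney_chaotic (N : ℕ) (hN : 1 ≤ N) :
    (∀ X : (ℕ → Fin N) × (Fin N → Bool), ∀ ε : ℝ, 0 < ε →
      ∃ Y : (ℕ → Fin N) × (Fin N → Bool),
        dX N X Y < ε ∧ ∃ n : ℕ, 1 ≤ n ∧ (Gf N (f0 N))^[n] Y = Y) ∧
    (∀ U V : Set ((ℕ → Fin N) × (Fin N → Bool)),
      (∀ x ∈ U, ∃ ε : ℝ, 0 < ε ∧ ∀ y, dX N x y < ε → y ∈ U) →
      (∀ x ∈ V, ∃ ε : ℝ, 0 < ε ∧ ∀ y, dX N x y < ε → y ∈ V) →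
      U.Nonempty → V.Nonempty →
      ∃ k : ℕ, 0 < k ∧ ((Gf N (f0 N))^[k] '' U ∩ V).Nonempty) := by
  constructor
  · rintro ⟨S, E⟩ ε hε
    obtain ⟨m, hm⟩ := ds_small N hN ε hε
    obtain ⟨l, hl, hS, hE⟩ := word N S E E m
    let P : ℕ → Fin N := fun n => l[n % l.length]'(Nat.mod_lt _ hl)
    have hP : prep l P = P := by
      funext n
      by_cases h : n < l.length
      · simp [prep, P, h, Nat.mod_eq_of_lt h]
      · simp only [prep, P, h, dite_false]
        congr 1
        exact (Nat.mod_eq_sub_mod (by omega)).symm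
    refine ⟨(P, E), ?_, l.length, hl, ?_⟩
    · have := hm S P (by rw [← hP]; exact hS P)
      simpa [dX, de_self] using this
    · have := iter_prep N l P E
      rwa [hP, hE] at this
  · rintro U V hU - ⟨⟨S, E⟩, hx⟩ ⟨⟨T, E'⟩, hy⟩
    obtain ⟨ε, hε, hball⟩ := hU _ hx
    obtain ⟨m, hm⟩ := ds_small N hN ε hε
    obtain ⟨l, hl, hS, hE⟩ := word N S E E' m
    refine ⟨l.length, hl, (T, E'), ⟨(prep l T, E), hball _ ?_, ?_⟩, hy⟩
    · simpa [dX, de_self] using hm S _ (hS T)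
    · rw [iter_prep, hE]
end

section
/- G_{f₀} has sensitive dependence on initial conditions on (𝒳, d) with sensitivity constant N − 1: for every point X ∈ 𝒳 and every δ > 0, there exist Y ∈ 𝒳 with d(X,Y) < δ and an integer n > 0 such that d(G_{f₀}^n(X), G_{f₀}^n(Y)) ≥ N − 1. -/
open scoped BigOperators

theorem ds_nonneg_aux (N : ℕ) (S T : ℕ → Fin N) : 0 ≤ ds N S T := by
  unfold ds
  exact mul_nonneg (by positivity) (tsum_nonneg fun k => by positivity)

theorem ds_le_aux (N : ℕ) (hN : 1 ≤ N) (S T : ℕ → Fin N) (m : ℕ)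
    (h : ∀ k < m, S k = T k) : ds N S T ≤ 18 * (1 / 5 : ℝ) ^ m := by
  have hN0 : (0 : ℝ) < N := by exact_mod_cast hN
  have hb : ∀ k, |((S k : ℕ) : ℝ) - ((T k : ℕ) : ℝ)| / 10 ^ (k + 1)
      ≤ (N * (1 / 5 : ℝ) ^ m) * (1 / 2 : ℝ) ^ k := by
    intro k
    by_cases hk : k < m
    · rw [h k hk]
      simp only [sub_self, abs_zero, zero_div]
      positivity
    · push Not at hk
      have h1 : |((S k : ℕ) : ℝ) - ((T k : ℕ) : ℝ)| ≤ N := by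
        have hS : ((S k : ℕ) : ℝ) < N := by exact_mod_cast (S k).2
        have hT : ((T k : ℕ) : ℝ) < N := by exact_mod_cast (T k).2
        have hS0 : (0 : ℝ) ≤ ((S k : ℕ) : ℝ) := by positivity
        have hT0 : (0 : ℝ) ≤ ((T k : ℕ) : ℝ) := by positivity
        rw [abs_le]
        constructor <;> linarith
      have h2 : (1 / 5 : ℝ) ^ k ≤ (1 / 5 : ℝ) ^ m :=
        pow_le_pow_of_le_one (by norm_num) (by norm_num) hk
      have h3 : (1 : ℝ) / 10 ^ (k + 1) ≤ (1 / 5 : ℝ) ^ k * (1 / 2 : ℝ) ^ k := by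
        rw [← mul_pow, show (1 / 5 * (1 / 2) : ℝ) = 1 / 10 by norm_num, one_div_pow]
        apply one_div_le_one_div_of_le (by positivity)
        exact pow_le_pow_right₀ (by norm_num) (by omega)
      calc _ = |((S k : ℕ) : ℝ) - ((T k : ℕ) : ℝ)| * (1 / 10 ^ (k + 1)) := by ring
        _ ≤ N * ((1 / 5 : ℝ) ^ k * (1 / 2 : ℝ) ^ k) := by gcongr
        _ ≤ N * ((1 / 5 : ℝ) ^ m * (1 / 2 : ℝ) ^ k) := by gcongr
        _ = _ := by ring
  have hs : Summable fun k => (N * (1 / 5 : ℝ) ^ m) * (1 / 2 : ℝ) ^ k :=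
    summable_geometric_two.mul_left _
  have hle := Summable.tsum_le_tsum hb
    (Summable.of_nonneg_of_le (fun k => by positivity) hb hs) hs
  rw [tsum_mul_left, tsum_geometric_two] at hle
  unfold ds
  calc _ ≤ (9 / N : ℝ) * (N * (1 / 5 : ℝ) ^ m * 2) := by gcongr
    _ = _ := by field_simp; norm_num

theorem Gf_iter_fst (N : ℕ) (X : (ℕ → Fin N) × (Fin N → Bool)) (n k : ℕ) :
    ((Gf N (f0 N))^[n] X).1 k = X.1 (k + n) := by
  induction n generalizing k with
  | zero => rfl
  | succ n ih =>
    rw [Function.iterate_succ_apply']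
    change ((Gf N (f0 N))^[n] X).1 (k + 1) = _
    rw [ih, show k + 1 + n = k + (n + 1) by omega]

theorem Gf_iter_snd (N : ℕ) (X : (ℕ → Fin N) × (Fin N → Bool)) (n : ℕ) (j : Fin N) :
    ((Gf N (f0 N))^[n + 1] X).2 j =
      if j = X.1 n then !(((Gf N (f0 N))^[n] X).2 j) else ((Gf N (f0 N))^[n] X).2 j := by
  rw [Function.iterate_succ_apply']
  change (if j = ((Gf N (f0 N))^[n] X).1 0 then _ else _) = _
  rw [Gf_iter_fst, zero_add]
  rfl

/-- `G_{f₀}` has sensitive dependence on initial conditions,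
with sensitivity constant `N - 1`. -/
theorem Gf0_sensitive (N : ℕ) (hN : 1 ≤ N) :
    ∀ X : (ℕ → Fin N) × (Fin N → Bool), ∀ δ : ℝ, 0 < δ →
      ∃ Y : (ℕ → Fin N) × (Fin N → Bool), dX N X Y < δ ∧
        ∃ n : ℕ, 0 < n ∧
          (N : ℝ) - 1 ≤ dX N ((Gf N (f0 N))^[n] X) ((Gf N (f0 N))^[n] Y) := by
  intro X δ hδ
  obtain ⟨m, hm⟩ := exists_pow_lt_of_lt_one (show 0 < δ / 18 by positivity)
    (show (1 / 5 : ℝ) < 1 by norm_num)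
  let z : Fin N := ⟨0, hN⟩
  let A : Fin N → Bool := ((Gf N (f0 N))^[m] X).2
  let B : Fin N → Bool := ((Gf N (f0 N))^[m + N] X).2
  let T : ℕ → Fin N := fun n => if n < m then X.1 n else
    if h : n - m < N then (if A ⟨n - m, h⟩ = B ⟨n - m, h⟩ then ⟨n - m, h⟩ else z) else z
  have hT : ∀ k < m, X.1 k = T k := fun k hk => by simp [T, hk]
  have hA : ∀ k ≤ m, ((Gf N (f0 N))^[k] (T, X.2)).2 = ((Gf N (f0 N))^[k] X).2 := by
    intro k
    induction k with
    | zero => intro _; rfl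
    | succ k ih =>
      intro hk
      funext j
      rw [Gf_iter_snd, Gf_iter_snd, ih (by omega), hT k (by omega)]
  have hB : ∀ k ≤ N, ∀ j : Fin N, j ≠ z → ((Gf N (f0 N))^[m + k] (T, X.2)).2 j =
      if (j : ℕ) < k ∧ A j = B j then !(A j) else A j := by
    intro k
    induction k with
    | zero => intro _ j _; simp [hA m le_rfl, A]
    | succ k ih =>
      intro hk j hj
      rw [← add_assoc, Gf_iter_snd, ih (by omega) j hj]
      have hTk : T (m + k) = if A ⟨k, hk⟩ = B ⟨k, hk⟩ then ⟨k, hk⟩ else z := by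
        have e : m + k - m = k := by omega
        have hk' : k < N := hk
        simp [T, e, hk']
      simp only [hTk]
      by_cases hjk : j = ⟨k, hk⟩
      · subst hjk
        by_cases hab : A ⟨k, hk⟩ = B ⟨k, hk⟩
        · simp [hab]
        · simp [hab, hj]
      · have h1 : (j : ℕ) ≠ k := fun h => hjk (Fin.ext h)
        have h2 : ((j : ℕ) < k + 1) ↔ (j : ℕ) < k := by omega
        have h3 : ¬ (j = if A ⟨k, hk⟩ = B ⟨k, hk⟩ then ⟨k, hk⟩ else z) := by
          split_ifs <;> assumption
        rw [if_neg h3]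
        simp only [h2]
  refine ⟨(T, X.2), ?_, m + N, by omega, ?_⟩
  · have h1 := ds_le_aux N hN X.1 T m hT
    have h2 : de N X.2 X.2 = 0 := by simp [de]
    simp only [dX, h2]
    push_cast
    linarith
  · have h1 := ds_nonneg_aux N ((Gf N (f0 N))^[m + N] X).1 ((Gf N (f0 N))^[m + N] (T, X.2)).1
    have h2 : N - 1 ≤ de N ((Gf N (f0 N))^[m + N] X).2 ((Gf N (f0 N))^[m + N] (T, X.2)).2 := by
      have hc : (Finset.univ.erase z).card = N - 1 := by simp
      rw [← hc]
      unfold de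
      apply Finset.card_le_card
      intro j hj
      have hj' : j ≠ z := (Finset.mem_erase.1 hj).1
      rw [Finset.mem_filter]
      refine ⟨Finset.mem_univ _, ?_⟩
      rw [hB N le_rfl j hj']
      change B j ≠ _
      have := j.2
      by_cases hab : A j = B j
      · simp [hab]
      · simp [hab, Ne.symm hab]
    have h3 : (N : ℝ) ≤ (de N ((Gf N (f0 N))^[m + N] X).2
        ((Gf N (f0 N))^[m + N] (T, X.2)).2 : ℝ) + 1 := by
      exact_mod_cast (by omega)
    unfold dX
    linarith
end

section
/- G_{f₀} is expansive on (𝒳, d) with expansivity constant 1: for all X, Y ∈ 𝒳 with X ≠ Y, there exists n ∈ ℕ such that d(G_{f₀}^n(X), G_{f₀}^n(Y)) ≥ 1. -/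
open scoped BigOperators

theorem iter_fst_aux (N : ℕ) (f : (Fin N → Bool) → (Fin N → Bool)) (n : ℕ) :
    ∀ (X : (ℕ → Fin N) × (Fin N → Bool)) (k : ℕ), ((Gf N f)^[n] X).1 k = X.1 (k + n) := by
  induction n with
  | zero => intro X k; rfl
  | succ n ih =>
    intro X k
    rw [Function.iterate_succ_apply, ih]
    rfl

theorem state_eq_aux (N : ℕ) (X Y : (ℕ → Fin N) × (Fin N → Bool)) (h : dX N X Y < 1) :
    X.2 = Y.2 := by
  by_contra hne
  obtain ⟨j, hj⟩ := Function.ne_iff.mp hne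
  have h1 : 1 ≤ de N X.2 Y.2 := Finset.card_pos.mpr ⟨j, by simp [hj]⟩
  have h2 : (1 : ℝ) ≤ de N X.2 Y.2 := by exact_mod_cast h1
  have h3 := ds_nonneg_aux N X.1 Y.1
  unfold dX at h
  linarith

theorem Ff_inj_aux (N : ℕ) (k l : Fin N) (E : Fin N → Bool)
    (h : Ff N (f0 N) k E = Ff N (f0 N) l E) : k = l := by
  by_contra hkl
  have := congrFun h k
  simp [Ff, f0, hkl] at this

/-- `G_{f₀}` is expansive with expansivity constant 1. -/
theorem Gf0_expansive (N : ℕ) (hN : 1 ≤ N) :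
    ∀ X Y : (ℕ → Fin N) × (Fin N → Bool), X ≠ Y →
      ∃ n : ℕ, 1 ≤ dX N ((Gf N (f0 N))^[n] X) ((Gf N (f0 N))^[n] Y) := by
  intro X Y hne
  by_contra! hcon
  have hst := fun n => state_eq_aux N _ _ (hcon n)
  apply hne
  refine Prod.ext (funext fun n => ?_) (hst 0)
  have h := hst (n + 1)
  rw [Function.iterate_succ_apply', Function.iterate_succ_apply'] at h
  simp only [Gf] at h
  change Ff N (f0 N) (((Gf N (f0 N))^[n] X).1 0) ((Gf N (f0 N))^[n] X).2 =
    Ff N (f0 N) (((Gf N (f0 N))^[n] Y).1 0) ((Gf N (f0 N))^[n] Y).2 at h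
  rw [hst n] at h
  have h2 := Ff_inj_aux N _ _ _ h
  rw [iter_fst_aux, iter_fst_aux] at h2
  simpa using h2
end

section
/- G_{f₀} is not A-expansive for any constant A > 1: there exist two distinct points X, Y ∈ 𝒳 (with the same strategy and states differing in exactly one cell) such that d(G_{f₀}^n(X), G_{f₀}^n(Y)) = 1 for every n ∈ ℕ. -/
open scoped BigOperators

theorem Gf0_step_aux (N : ℕ) (n : ℕ) : ∀ X Y : (ℕ → Fin N) × (Fin N → Bool), X.1 = Y.1 →
    de N X.2 Y.2 = 1 →
      dX N ((Gf N (f0 N))^[n] X) ((Gf N (f0 N))^[n] Y) = 1 := by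
  induction n with
  | zero =>
    intro X Y h1 h2
    simp [dX, ds, h1, h2]
  | succ n ih =>
    intro X Y h1 h2
    rw [Function.iterate_succ_apply, Function.iterate_succ_apply]
    apply ih
    · simp [Gf, h1]
    · rw [← h2]
      unfold de
      congr 1
      apply Finset.filter_congr
      intro j _
      simp only [Gf, Ff, f0, h1]
      split_ifs <;> simp

/-- `G_{f₀}` is not `A`-expansive for any `A > 1`: there are distinct
points with the same strategy, differing in exactly one cell, whose iterates
always remain at distance exactly 1. -/
theorem Gf0_not_A_expansive (N : ℕ) (hN : 1 ≤ N) :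
    ∃ X Y : (ℕ → Fin N) × (Fin N → Bool), X ≠ Y ∧ X.1 = Y.1 ∧
      de N X.2 Y.2 = 1 ∧
      ∀ n : ℕ, dX N ((Gf N (f0 N))^[n] X) ((Gf N (f0 N))^[n] Y) = 1 := by
  have key : de N (fun _ => false) (fun j => decide (j = (⟨0, hN⟩ : Fin N))) = 1 := by
    simp [de, Finset.filter_eq']
  refine ⟨(fun _ => ⟨0, hN⟩, fun _ => false),
    (fun _ => ⟨0, hN⟩, fun j => decide (j = (⟨0, hN⟩ : Fin N))), ?_, rfl, key,
    fun n => Gf0_step_aux N n _ _ rfl key⟩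
  intro h
  have := congrFun (congrArg Prod.snd h) ⟨0, hN⟩
  simp at this
end
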